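/- Let N = 10, y ∈ ℂ nonzero, and Δ = −(y + 1/y)/2. Let r ∈ ℂ be nonzero with r + 1/r ≠ −2Δ and suppose r satisfies r¹⁰ + (5Δ+2)r⁹ + 2(2Δ+1)²r⁸ + 2(2Δ+1)(Δ+1)²(r⁷+r⁶+r⁵+r⁴+r³) + 2(2Δ+1)²r² + (5Δ+2)r + 1 = 0. Set σ = −(2Δ(r + 1/r) + 4)/(r + 1/r + 2Δ). Then the polynomial (z² − σz + 1)(z + 1) divides, in ℂ[z], the polynomial H₅(z) = (z − y)⁹(zy³ − 1)(z²y⁴ − σ z y² + 1)(zy² + 1) + (zy − 1)⁹(z − y³)(z² − σ z y² + y⁴)(z + y²). -/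

import Mathlib

open Polynomial

/-- The polynomials `V_k(s)` with `V_k(z + 1/z) = (z^(k+1) + z^(-k)) / (z + 1)`. -/
def oddChebyshev {R : Type*} [CommRing R] (s : R) : ℕ → R
  | 0 => 1
  | 1 => s - 1
  | k + 2 => s * oddChebyshev s (k + 1) - oddChebyshev s k

theorem dvd_one_add_pow_sub_oddChebyshev {R : Type*} [CommRing R] (s z : R) :
    ∀ k : ℕ, (z^2 - s * z + 1) * (z + 1) ∣
      1 + z^(2*k+1) - oddChebyshev s k * z^k * (z + 1)
  | 0 => ⟨0, by simp only [oddChebyshev]; ring⟩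
  | 1 => ⟨1, by simp only [oddChebyshev]; ring⟩
  | k + 2 => by
    have h₀ := dvd_one_add_pow_sub_oddChebyshev s z k
    have h₁ := dvd_one_add_pow_sub_oddChebyshev s z (k + 1)
    have hodd : z + 1 ∣ z^(2*k+3) + 1 := by
      have hk : Odd (2*k+3) := ⟨k + 1, by ring⟩
      simpa using hk.add_dvd_pow_add_pow z 1
    have h₂ := mul_dvd_mul_left (z^2 - s * z + 1) hodd
    convert (h₂.add (h₁.mul_left (s * z))).sub (h₀.mul_left (z^2)) using 1
    simp only [oddChebyshev]
    ring

/-- The coefficients of `z^j` and `z^(13-j)` in the palindromic polynomial `H₅(z) / y^9`,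
expressed through `w = y + 1/y` and `s = σ`. -/
def palindromicCoeff (w s : ℂ) : ℕ → ℂ
  | 0 => 2
  | 1 => -w^3 + w^2 - 6*w - 2
      + (-w^2 + 2)*s
  | 2 => -w^5 + w^4 + 5*w^3 + 41*w^2 - 14*w - 88
      + (w^5 - w^4 - 5*w^3 + 4*w^2 + 14*w - 2)*s
  | 3 => -w^7 + w^6 + 7*w^5 + 3*w^4 - 107*w^3 - 27*w^2 + 250*w + 88
      + (w^7 - 7*w^5 - 9*w^4 + 23*w^3 + 36*w^2 - 34*w - 90)*s
  | 4 => -w^9 + 9*w^7 + 9*w^6 - 36*w^5 + 72*w^4 + 39*w^3 - 387*w^2 - 30*w + 330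
      + (-9*w^6 + 54*w^4 + 36*w^3 - 117*w^2 - 24*w + 90)*s
  | 5 => 9*w^8 - 72*w^6 - 162*w^5 + 216*w^4 + 810*w^3 - 78*w^2 - 1020*w - 330
      + (36*w^5 - 180*w^3 - 210*w^2 + 264*w + 420)*s
  | 6 => -36*w^7 + 84*w^6 + 252*w^5 - 420*w^4 - 714*w^3 + 546*w^2 + 756*w
      + (-84*w^4 + 126*w^3 + 336*w^2 - 252*w - 420)*s
  | _ => 0

/-- The value at `z + 1/z = s` of `H₅(z) / (y^9 z^6 (z + 1))`, where `w = y + 1/y`. -/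
def reducedValue (w s : ℂ) : ℂ :=
  (w^9 - 9*w^8 - 46*w^7 + 148*w^6 + 456*w^5 - 704*w^4 - 1664*w^3 + 1024*w^2 + 2048*w)
    + (w^9 + 9*w^8 - 6*w^7 - 74*w^6 - 184*w^5 - 8*w^4 + 1280*w^3 + 1152*w^2 - 2048*w - 2048)*s
    + (-w^9 + 8*w^7 + 17*w^6 + 12*w^5 + 28*w^4 - 144*w^3 - 640*w^2 + 128*w + 1024)*s^2
    + (-2*w^7 - 8*w^6 + 12*w^5 + 68*w^4 - 80*w^3 - 240*w^2 + 256*w + 384)*s^3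
    + (w^7 - 9*w^5 - 7*w^4 + 34*w^3 + 76*w^2 - 56*w - 192)*s^4
    + (w^5 - w^4 - 6*w^3 + 6*w^2 + 8*w - 8)*s^5
    + (-w^2 + 4)*s^6

theorem sum_palindromicCoeff_mul_oddChebyshev (w s : ℂ) :
    ∑ j ∈ Finset.range 7, palindromicCoeff w s j * oddChebyshev s (6 - j)
      = reducedValue w s := by
  simp only [Finset.sum_range_succ, Finset.sum_range_zero, palindromicCoeff, oddChebyshev,
    reducedValue, Nat.reduceSub]
  ring

theorem eq_sum_palindromicCoeff (y w σ z : ℂ) (hy : y ≠ 0) (hw : w = y + 1/y) :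
    (z - y)^9 * (z * y^3 - 1) * (z^2 * y^4 - σ * z * y^2 + 1) * (z * y^2 + 1)
        + (z * y - 1)^9 * (z - y^3) * (z^2 - σ * z * y^2 + y^4) * (z + y^2)
      = ∑ j ∈ Finset.range 7,
          y^9 * palindromicCoeff w σ j * z^j * (1 + z^(2*(6-j)+1)) := by
  subst hw
  simp only [Finset.sum_range_succ, Finset.sum_range_zero, palindromicCoeff, Nat.reduceSub,
    Nat.reduceMul, Nat.reduceAdd]
  field_simp
  ring

theorem reducedValue_eq_zero (w r s : ℂ) (hden : r^2 + 1 - w * r ≠ 0)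
    (hs : s * (r^2 + 1 - w * r) = w * (r^2 + 1) - 4 * r)
    (hroot : 2*r^10 + (4 - 5*w)*r^9 + 4*(1-w)^2*r^8
        + (1-w)*(2-w)^2*(r^7+r^6+r^5+r^4+r^3)
        + 4*(1-w)^2*r^2 + (4 - 5*w)*r + 2 = 0) :
    reducedValue w s = 0 := by
  have hs' : s = (w * (r^2 + 1) - 4 * r) / (r^2 + 1 - w * r) := by
    rw [eq_div_iff hden, hs]
  have key : reducedValue w s * (r^2 + 1 - w * r)^6 = (w^2 - 4)^6 * r *
      (2*r^10 + (4 - 5*w)*r^9 + 4*(1-w)^2*r^8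
        + (1-w)*(2-w)^2*(r^7+r^6+r^5+r^4+r^3)
        + 4*(1-w)^2*r^2 + (4 - 5*w)*r + 2) := by
    rw [hs', reducedValue]
    generalize hd : r^2 + 1 - w * r = d at hden
    field_simp
    subst hd
    ring
  rw [hroot, mul_zero] at key
  exact (mul_eq_zero.mp key).resolve_right (pow_ne_zero 6 hden)

/-- For `N = 10`, `y ≠ 0`, `Δ = −(y + 1/y)/2`, and `r ≠ 0` a root of the degree-10
reciprocal polynomial `r¹⁰ + (5Δ+2)r⁹ + 2(2Δ+1)²r⁸ + 2(2Δ+1)(Δ+1)²(r⁷+r⁶+r⁵+r⁴+r³)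
+ 2(2Δ+1)²r² + (5Δ+2)r + 1` with `r + 1/r ≠ −2Δ`, setting
`σ = −(2Δ(r + 1/r) + 4)/(r + 1/r + 2Δ)`, the polynomial `(z² − σz + 1)(z + 1)`
divides `H₅(z) = (z−y)⁹(zy³−1)(z²y⁴−σzy²+1)(zy²+1)
+ (zy−1)⁹(z−y³)(z²−σzy²+y⁴)(z+y²)` in `ℂ[z]`. -/
theorem n5_boundPair_divisibility (y : ℂ) (hy : y ≠ 0) (Δ : ℂ)
    (hΔ : Δ = -(y + 1/y)/2) (r : ℂ) (hr : r ≠ 0) (hden : r + 1/r ≠ -(2*Δ))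
    (hroot : r^10 + (5*Δ+2)*r^9 + 2*(2*Δ+1)^2*r^8
        + 2*(2*Δ+1)*(Δ+1)^2*(r^7+r^6+r^5+r^4+r^3)
        + 2*(2*Δ+1)^2*r^2 + (5*Δ+2)*r + 1 = 0)
    (σ : ℂ) (hσ : σ = -(2*Δ*(r + 1/r) + 4)/(r + 1/r + 2*Δ)) :
    ((X^2 - C σ * X + 1) * (X + 1) : Polynomial ℂ) ∣
      ((X - C y)^9 * (X * C y^3 - 1) * (X^2 * C y^4 - C σ * X * C y^2 + 1)
          * (X * C y^2 + 1)
        + (X * C y - 1)^9 * (X - C y^3) * (X^2 - C σ * X * C y^2 + C y^4)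
          * (X + C y^2)) := by
  have hw : -(2*Δ) = y + 1/y := by rw [hΔ]; ring
  have hden' : r^2 + 1 - -(2*Δ) * r ≠ 0 := by
    intro h
    apply hden
    field_simp
    linear_combination h
  have hzero : reducedValue (-(2*Δ)) σ = 0 := by
    refine reducedValue_eq_zero _ r σ hden' ?_ (by linear_combination 2 * hroot)
    have hd : r + 1/r + 2*Δ ≠ 0 := fun h => hden (by linear_combination h)
    have hmul := (eq_div_iff hd).mp hσ
    field_simp at hmul
    linear_combination hmul
  have hsum := sum_palindromicCoeff_mul_oddChebyshev (-(2*Δ)) σ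
  rw [hzero] at hsum
  have hH : (X - C y)^9 * (X * C y^3 - 1) * (X^2 * C y^4 - C σ * X * C y^2 + 1)
          * (X * C y^2 + 1)
        + (X * C y - 1)^9 * (X - C y^3) * (X^2 - C σ * X * C y^2 + C y^4)
          * (X + C y^2)
      = ∑ j ∈ Finset.range 7, C (y^9 * palindromicCoeff (-(2*Δ)) σ j) * X^j *
          (1 + X^(2*(6-j)+1)) := by
    refine Polynomial.funext fun z => ?_
    simpa [eval_finsetSum, mul_comm y z] using eq_sum_palindromicCoeff y _ σ z hy hw
  have hV : ∀ k, oddChebyshev (C σ) k = C (oddChebyshev σ k) := by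
    intro k
    induction k using Nat.twoStepInduction with
    | zero => simp [oddChebyshev]
    | one => simp [oddChebyshev]
    | more k h₀ h₁ => simp [oddChebyshev, h₀, h₁]
  have hsplit : ∑ j ∈ Finset.range 7, C (y^9 * palindromicCoeff (-(2*Δ)) σ j) * X^j *
          (1 + X^(2*(6-j)+1))
      = ∑ j ∈ Finset.range 7, C (y^9 * palindromicCoeff (-(2*Δ)) σ j) * X^j *
          (1 + X^(2*(6-j)+1) - oddChebyshev (C σ) (6-j) * X^(6-j) * (X + 1)) := by
    rw [← sub_eq_zero, ← Finset.sum_sub_distrib]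
    calc _ = ∑ j ∈ Finset.range 7, C (y^9) * X^6 * (X + 1) *
            C (palindromicCoeff (-(2*Δ)) σ j * oddChebyshev σ (6-j)) := by
          refine Finset.sum_congr rfl fun j hj => ?_
          have hj6 : j + (6 - j) = 6 := by
            have := Finset.mem_range.mp hj
            omega
          have hX : (X : ℂ[X])^6 = X^j * X^(6-j) := by rw [← pow_add, hj6]
          rw [hV, hX, C_mul, C_mul]
          ring
      _ = 0 := by rw [← Finset.mul_sum, ← map_sum, hsum, C_0, mul_zero]
  rw [hH, hsplit]
  exact Finset.dvd_sum fun j _ =>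
    (dvd_one_add_pow_sub_oddChebyshev (C σ) X (6 - j)).mul_left _
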